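/- For every integer n ≥ 1, the sum over all type-B permutation tableaux T of size n of the number of south steps of T (i.e., the number of rows of the underlying unshifted Ferrers diagram) equals ((n+1)/4)·|B_n|; equivalently, the expected number of rows of a uniformly random type-B permutation tableau of size n is (n+1)/4. -/

import Mathlib

/-- A type-B permutation tableau of size `n`, encoded via its border steps and filling.

Border steps are indexed by `Fin n` (index `i` is the `(i+1)`-th step from the
northeast corner); `west i = true` means the `(i+1)`-th step is a west step
(giving a column) and `west i = false` means it is a south step (giving a row
of the original, unshifted diagram).

Rows of the shifted diagram are also indexed by `Fin n`: a south step `r` indexes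
the corresponding original row, and a west step `r` indexes the inserted diagonal
row whose diagonal cell lies in the column of `r`.  The cell in row `r` and the
column of a west step `c` exists iff (`r` is south and `r < c`) or (`r` is west
and `r ≤ c`); in particular the diagonal cell of the column of `c` is `(c, c)`.
Columns are ordered left-to-right by decreasing step index, rows top-to-bottom as:
diagonal rows by decreasing step index, then original rows by increasing step index.

`filling r c = true` means the cell `(r, c)` contains a 1; `filling` is `false`
outside the cells of the diagram (field `support`).  The fields `col_one`,
`no_bad_zero` and `diag_zero` are the three defining conditions of a type-B
permutation tableau. -/
structure TypeBTableau (n : ℕ) where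
  west : Fin n → Bool
  filling : Fin n → Fin n → Bool
  support : ∀ r c : Fin n, filling r c = true →
    west c = true ∧ ((west r = false ∧ (r : ℕ) < (c : ℕ)) ∨ (west r = true ∧ (r : ℕ) ≤ (c : ℕ)))
  col_one : ∀ c : Fin n, west c = true → ∃ r : Fin n, filling r c = true
  no_bad_zero : ∀ r c : Fin n,
    (west c = true ∧ ((west r = false ∧ (r : ℕ) < (c : ℕ)) ∨ (west r = true ∧ (r : ℕ) ≤ (c : ℕ)))) →
    filling r c = false →
    ¬((∃ r' : Fin n,
        ((west r' = true ∧ west r = false) ∨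
         (west r' = true ∧ west r = true ∧ (r : ℕ) < (r' : ℕ)) ∨
         (west r' = false ∧ west r = false ∧ (r' : ℕ) < (r : ℕ))) ∧
        filling r' c = true) ∧
      (∃ c' : Fin n, (c : ℕ) < (c' : ℕ) ∧ filling r c' = true))
  diag_zero : ∀ j : Fin n, west j = true → filling j j = false →
    ∀ c : Fin n, filling j c = false

namespace TypeBTableau

noncomputable instance instFintype {n : ℕ} : Fintype (TypeBTableau n) :=
  Fintype.ofInjective (fun T => (T.west, T.filling)) (by
    rintro ⟨w1, f1, _, _, _, _⟩ ⟨w2, f2, _, _, _, _⟩ h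
    simp only [Prod.mk.injEq] at h
    obtain ⟨h1, h2⟩ := h
    subst h1; subst h2; rfl)

end TypeBTableau

open Finset

/-- The number of rows of (the original, unshifted Ferrers diagram of) a type-B
permutation tableau, i.e. its number of south border steps. -/
def TypeBTableau.numRows {n : ℕ} (T : TypeBTableau n) : ℕ :=
  (Finset.univ.filter (fun i : Fin n => T.west i = false)).card

namespace TypeBTableau

theorem pow_sum {ι : Type} (V : Finset ι) (u : ℝ) :
    ∑ S ∈ V.powerset, u ^ S.card = (1 + u) ^ V.card := by
  have := Finset.sum_pow_mul_eq_add_pow u 1 V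
  simpa [add_comm] using this

theorem ext_wf {n : ℕ} {T T' : TypeBTableau n} (h1 : T.west = T'.west)
    (h2 : T.filling = T'.filling) : T = T' := by
  cases T; cases T'; simp only at h1 h2; subst h1; subst h2; rfl

def key {n : ℕ} (w : Fin n → Bool) (r : Fin n) : ℤ :=
  if w r = true then -((r : ℕ) : ℤ) - 1 else ((r : ℕ) : ℤ)

theorem above_iff {n : ℕ} (w : Fin n → Bool) (r' r : Fin n) :
    ((w r' = true ∧ w r = false) ∨
         (w r' = true ∧ w r = true ∧ (r : ℕ) < (r' : ℕ)) ∨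
         (w r' = false ∧ w r = false ∧ (r' : ℕ) < (r : ℕ))) ↔ key w r' < key w r := by
  unfold key
  cases w r <;> cases w r' <;> simp <;> omega

def Cell {n : ℕ} (w : Fin n → Bool) (r c : Fin n) : Prop :=
  w c = true ∧ ((w r = false ∧ (r : ℕ) < (c : ℕ)) ∨ (w r = true ∧ (r : ℕ) ≤ (c : ℕ)))

theorem nbz {n : ℕ} (T : TypeBTableau n) {r c r' c' : Fin n} (h : Cell T.west r c)
    (hf : T.filling r c = false) (hk : key T.west r' < key T.west r)
    (h1 : T.filling r' c = true) (hc : (c : ℕ) < c') : T.filling r c' = false := by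
  by_contra h2
  exact T.no_bad_zero r c h hf ⟨⟨r', (above_iff _ _ _).2 hk, h1⟩, c', hc, by simpa using h2⟩

/-- Unrestricted rows. -/
def Unr {n : ℕ} (T : TypeBTableau n) (r : Fin n) : Prop :=
  (T.west r = true → T.filling r r = true) ∧
  ∀ c, Cell T.west r c → T.filling r c = false →
    ∀ r', key T.west r' < key T.west r → T.filling r' c = false

open Classical in
noncomputable def U {n : ℕ} (T : TypeBTableau n) : Finset (Fin n) :=
  Finset.univ.filter T.Unr

theorem mem_U {n : ℕ} (T : TypeBTableau n) (r : Fin n) : r ∈ T.U ↔ T.Unr r := by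
  simp [U]

theorem key_castSucc {n : ℕ} (w : Fin (n+1) → Bool) (r : Fin n) :
    key w r.castSucc = key (fun i => w i.castSucc) r := by
  simp [key]

/-- Remove the last step. -/
def res {n : ℕ} (T : TypeBTableau (n+1)) : TypeBTableau n where
  west := fun i => T.west i.castSucc
  filling := fun r c => T.filling r.castSucc c.castSucc
  support := fun r c h => by simpa using T.support _ _ h
  col_one := fun c hc => by
    obtain ⟨r, hr⟩ := T.col_one _ hc
    have := T.support _ _ hr
    have hr' : (r : ℕ) < n := by
      have := c.2
      simp at *
      omega
    exact ⟨⟨r, hr'⟩, hr⟩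
  no_bad_zero := fun r c h hf => by
    rintro ⟨⟨r', h1, h2⟩, c', h3, h4⟩
    exact T.no_bad_zero r.castSucc c.castSucc (by simpa using h) hf
      ⟨⟨r'.castSucc, by simpa using h1, h2⟩, c'.castSucc, by simpa using h3, h4⟩
  diag_zero := fun j hj h c => T.diag_zero _ hj h _

def ew {n : ℕ} (w : Fin n → Bool) (b : Bool) (S : Finset (Fin n)) : Fin (n+1) → Bool :=
  Fin.lastCases (b || decide (S.Nonempty)) w

def ef {n : ℕ} (f : Fin n → Fin n → Bool) (b : Bool) (S : Finset (Fin n)) :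
    Fin (n+1) → Fin (n+1) → Bool :=
  fun r c => Fin.lastCases (motive := fun _ => Bool)
    (Fin.lastCases (motive := fun _ => Bool) b (fun r => decide (r ∈ S)) r)
    (fun c => Fin.lastCases (motive := fun _ => Bool) false (fun r => f r c) r) c

section
variable {n : ℕ} (w : Fin n → Bool) (f : Fin n → Fin n → Bool) (b : Bool) (S : Finset (Fin n))
@[simp] theorem ew_last : ew w b S (Fin.last n) = (b || decide (S.Nonempty)) := by simp [ew]
@[simp] theorem ew_cast (i : Fin n) : ew w b S i.castSucc = w i := by simp [ew]
@[simp] theorem ef_ll : ef f b S (Fin.last n) (Fin.last n) = b := by simp [ef]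
@[simp] theorem ef_lc (i : Fin n) : ef f b S (Fin.last n) i.castSucc = false := by simp [ef]
@[simp] theorem ef_cl (i : Fin n) : ef f b S i.castSucc (Fin.last n) = decide (i ∈ S) := by
  simp [ef]
@[simp] theorem ef_cc (i j : Fin n) : ef f b S i.castSucc j.castSucc = f i j := by simp [ef]
@[simp] theorem key_ew (i : Fin n) : key (ew w b S) i.castSucc = key w i := by
  simp [key_castSucc]
theorem key_ew_last (h : (b || decide S.Nonempty) = true) (i : Fin n) :
    key (ew w b S) (Fin.last n) < key w i := by
  have := i.2
  simp only [key, ew_last, h, if_true, Fin.val_last]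
  split <;> omega
@[simp] theorem cell_cc (i j : Fin n) : Cell (ew w b S) i.castSucc j.castSucc ↔ Cell w i j := by
  simp [Cell]
theorem cell_lc (j : Fin n) : ¬ Cell (ew w b S) (Fin.last n) j.castSucc := by
  have := j.2
  simp [Cell]
theorem cell_cl (i : Fin n) : Cell (ew w b S) i.castSucc (Fin.last n) ↔
    (b || decide S.Nonempty) = true := by
  have := i.2
  simp only [Cell, ew_last, ew_cast, Fin.val_castSucc, Fin.val_last]
  cases w i <;> simp
theorem cell_ll : Cell (ew w b S) (Fin.last n) (Fin.last n) ↔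
    (b || decide S.Nonempty) = true := by
  simp [Cell]
end

def addStep {n : ℕ} (T : TypeBTableau n) (b : Bool) (S : Finset (Fin n)) (hS : S ⊆ T.U) :
    TypeBTableau (n+1) where
  west := ew T.west b S
  filling := ef T.filling b S
  support := by
    intro r c
    change _ → Cell _ r c
    induction r using Fin.lastCases <;> induction c using Fin.lastCases
    · simp only [ef_ll, cell_ll]; simp +contextual
    · simp
    · simp only [ef_cl, cell_cl, decide_eq_true_eq, Bool.or_eq_true]
      exact fun h => Or.inr ⟨_, h⟩
    · simp only [ef_cc, cell_cc]; exact T.support _ _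
  col_one := by
    intro c
    induction c using Fin.lastCases with
    | last =>
      simp only [ew_last, Bool.or_eq_true, decide_eq_true_eq]
      rintro (h | ⟨r, h⟩)
      · exact ⟨Fin.last n, by simp [h]⟩
      · exact ⟨r.castSucc, by simp [h]⟩
    | cast c =>
      simp only [ew_cast]
      intro h
      obtain ⟨r, hr⟩ := T.col_one c h
      exact ⟨r.castSucc, by simp [hr]⟩
  no_bad_zero := by
    intro r c h hf
    rintro ⟨⟨r', h1, h2⟩, c', h3, h4⟩
    change Cell _ r c at h
    rw [above_iff] at h1
    induction c using Fin.lastCases with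
    | last => have := c'.2; simp at h3; omega
    | cast c =>
      induction r using Fin.lastCases with
      | last => exact cell_lc _ _ _ _ h
      | cast r =>
        induction r' using Fin.lastCases with
        | last => simp at h2
        | cast r' =>
          simp only [cell_cc, key_ew, ef_cc] at *
          induction c' using Fin.lastCases with
          | last =>
            simp only [ef_cl, decide_eq_true_eq] at h4
            have := hS h4
            simp only [U, Finset.mem_filter, Finset.mem_univ, true_and] at this
            have := this.2 c h hf r' h1
            simp [h2] at this
          | cast c' =>
            simp only [ef_cc, Fin.val_castSucc] at *
            have := T.nbz h hf h1 h2 h3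
            simp [h4] at this
  diag_zero := by
    intro j hj h c
    induction j using Fin.lastCases with
    | last =>
      induction c using Fin.lastCases with
      | last => exact h
      | cast c => simp
    | cast j =>
      simp only [ew_cast, ef_cc] at hj h
      induction c using Fin.lastCases with
      | last =>
        simp only [ef_cl, decide_eq_false_iff_not]
        intro h4
        have := hS h4
        simp only [U, Finset.mem_filter, Finset.mem_univ, true_and] at this
        have := this.1 hj
        simp [h] at this
      | cast c => simpa using T.diag_zero j hj h c

theorem addStep_west {n : ℕ} (T : TypeBTableau n) (b : Bool) (S : Finset (Fin n)) (hS : S ⊆ T.U) :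
    (T.addStep b S hS).west = ew T.west b S := rfl

theorem addStep_filling {n : ℕ} (T : TypeBTableau n) (b : Bool) (S : Finset (Fin n))
    (hS : S ⊆ T.U) : (T.addStep b S hS).filling = ef T.filling b S := rfl

open Classical in
theorem U_addStep {n : ℕ} (T : TypeBTableau n) (b : Bool) (S : Finset (Fin n)) (hS : S ⊆ T.U) :
    (T.addStep b S hS).U = (if b = true ∨ S = ∅ then {Fin.last n} else ∅) ∪
      (T.U.filter (fun r => r ∈ S ∨ (b = false ∧ ∀ r' ∈ S, ¬ key T.west r' < key T.west r))).map
        Fin.castSuccEmb := by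
  ext r
  induction r using Fin.lastCases with
  | last =>
    have h1 : ∀ x : Fin n, x.castSucc ≠ Fin.last n := fun x => (Fin.castSucc_lt_last x).ne
    have : Fin.last n ∈ (T.addStep b S hS).U ↔ (b = true ∨ S = ∅) := by
      simp only [mem_U, Unr, addStep_west, addStep_filling, ew_last, ef_ll]
      constructor
      · rintro ⟨h, -⟩
        by_contra! hc
        simp [hc.1, hc.2] at h
      · intro h
        refine ⟨?_, ?_⟩
        · rcases h with h | h <;> simp [h]
        · intro c hc hf
          induction c using Fin.lastCases with
          | last =>
            simp only [cell_ll, ef_ll] at hc hf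
            rcases h with h | h <;> simp_all
          | cast c => exact absurd hc (cell_lc _ _ _ _)
    rw [this]
    by_cases h : b = true ∨ S = ∅
    · simp [h]
    · simp [h, h1]
  | cast r =>
    have h1 : ∀ x : Fin n, x.castSucc ≠ Fin.last n := fun x => (Fin.castSucc_lt_last x).ne
    have : r.castSucc ∈ (T.addStep b S hS).U ↔ (r ∈ T.U ∧ (r ∈ S ∨
        (b = false ∧ ∀ r' ∈ S, ¬ key T.west r' < key T.west r))) := by
      simp only [mem_U, Unr, addStep_west, addStep_filling, ew_cast, ef_cc,
        Fin.forall_fin_succ', ef_cl, ef_ll, ef_lc, key_ew, cell_cc, cell_cl, and_assoc, implies_true, and_true]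
      refine and_congr_right fun _ => and_congr_right fun _ => ?_
      constructor
      · intro h
        by_cases hr : r ∈ S
        · exact Or.inl hr
        · right
          have hb : b = false := by
            by_contra hb
            simp only [Bool.not_eq_false] at hb
            have := (h (by simp [hb]) (by simp [hr])).2 (key_ew_last _ _ _ (by simp [hb]) _)
            simp [hb] at this
          refine ⟨hb, fun r' hr' hk => ?_⟩
          have := (h (by simp [show S.Nonempty from ⟨_, hr'⟩]) (by simp [hr])).1 r' hk
          simp [hr'] at this
      · rintro (h | ⟨h, h2⟩) h3 h4
        · simp [h] at h4
        · exact ⟨fun r' hk => by simpa using fun hr' => h2 r' hr' hk, fun _ => h⟩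
    rw [this]
    split_ifs <;> simp [h1]

theorem numRows_addStep {n : ℕ} (T : TypeBTableau n) (b : Bool) (S : Finset (Fin n))
    (hS : S ⊆ T.U) : (T.addStep b S hS).numRows =
      T.numRows + if b = false ∧ S = ∅ then 1 else 0 := by
  have key1 : (T.addStep b S hS).numRows = ∑ i, if ew T.west b S i = false then 1 else 0 := by
    rw [numRows, Finset.card_filter]; rfl
  rw [key1, numRows, Finset.card_filter, Fin.sum_univ_castSucc]
  simp only [ew_cast, ew_last]
  congr 1
  cases b <;> simp [Finset.not_nonempty_iff_eq_empty]


theorem res_addStep {n : ℕ} (T : TypeBTableau n) (b : Bool) (S : Finset (Fin n)) (hS : S ⊆ T.U) :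
    (T.addStep b S hS).res = T := by
  apply ext_wf <;> simp [res, addStep]

def glue {n : ℕ} (x : Σ T : TypeBTableau n, Bool × {S : Finset (Fin n) // S ⊆ T.U}) :
    TypeBTableau (n+1) := x.1.addStep x.2.1 x.2.2.1 x.2.2.2

theorem glue_inj {n : ℕ} : Function.Injective (glue (n := n)) := by
  rintro ⟨T, b, S, hS⟩ ⟨T', b', S', hS'⟩ h
  have h1 : T = T' := by
    have := congrArg res h
    simpa [glue, res_addStep] using this
  subst h1
  have hf : ef T.filling b S = ef T.filling b' S' := congrArg filling h
  have hb : b = b' := by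
    have := congrFun (congrFun hf (Fin.last n)) (Fin.last n)
    simpa using this
  have hs : S = S' := by
    ext r
    have := congrFun (congrFun hf r.castSucc) (Fin.last n)
    simpa using this
  subst hb; subst hs; rfl

theorem glue_surj {n : ℕ} : Function.Surjective (glue (n := n)) := by
  intro T
  have hw : ∀ r : Fin (n+1), T.filling r (Fin.last n) = true → T.west (Fin.last n) = true :=
    fun r h => (T.support _ _ h).1
  let S : Finset (Fin n) := univ.filter fun r => T.filling r.castSucc (Fin.last n) = true
  have hS : S ⊆ T.res.U := by
    intro r hr
    simp only [S, Finset.mem_filter, Finset.mem_univ, true_and] at hr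
    simp only [U, Finset.mem_filter, Finset.mem_univ, true_and]
    refine ⟨fun h => ?_, fun c hc hf r' hk => ?_⟩
    · by_contra hf
      have := T.diag_zero r.castSucc h (by simpa [res] using hf) (Fin.last n)
      simp [hr] at this
    · by_contra h1
      have := T.nbz (r := r.castSucc) (c := c.castSucc) (r' := r'.castSucc) (c' := Fin.last n)
        (by simpa [Cell, res] using hc) hf
        (by simpa [key_castSucc, res] using hk) (by simpa [res] using h1) (by simp)
      simp [hr] at this
  refine ⟨⟨T.res, T.filling (Fin.last n) (Fin.last n), S, hS⟩, ?_⟩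
  apply ext_wf
  · funext r
    simp only [glue, addStep]
    induction r using Fin.lastCases with
    | last =>
      rw [ew_last, Bool.eq_iff_iff, Bool.or_eq_true, decide_eq_true_eq]
      constructor
      · rintro (h | ⟨r, h⟩)
        · exact hw _ h
        · exact hw r.castSucc (by simpa [S] using h)
      · intro h
        obtain ⟨r, hr⟩ := T.col_one _ h
        induction r using Fin.lastCases with
        | last => exact Or.inl hr
        | cast r => exact Or.inr ⟨r, by simpa [S] using hr⟩
    | cast r => simp [res]
  · funext r c
    simp only [glue, addStep]
    induction r using Fin.lastCases <;> induction c using Fin.lastCases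
    · simp
    · rename_i c
      rw [ef_lc]
      symm
      by_contra h
      have := T.support _ _ (by simpa using h)
      have hc := c.2
      simp at this
      omega
    · simp [S]
    · simp [res]

theorem sum_glue {n : ℕ} (g : TypeBTableau (n+1) → ℝ) (h : TypeBTableau n → Bool → Finset (Fin n) → ℝ)
    (hg : ∀ T b S hS, g (addStep T b S hS) = h T b S) :
    ∑ T, g T = ∑ T : TypeBTableau n, (∑ S ∈ T.U.powerset, h T true S +
      ∑ S ∈ T.U.powerset, h T false S) := by
  classical
  rw [← Function.Bijective.sum_comp ⟨glue_inj, glue_surj⟩ g, Fintype.sum_sigma]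
  refine Finset.sum_congr rfl fun T _ => ?_
  rw [Fintype.sum_prod_type, Fintype.sum_bool]
  congr 1
  · rw [Finset.sum_subtype (p := fun S => S ⊆ T.U) _ (fun S => by simp)]
    exact Finset.sum_congr rfl fun S _ => hg _ _ _ _
  · rw [Finset.sum_subtype (p := fun S => S ⊆ T.U) _ (fun S => by simp)]
    exact Finset.sum_congr rfl fun S _ => hg _ _ _ _

theorem key_inj {n : ℕ} (w : Fin n → Bool) : Function.Injective (key w) := by
  intro a b h
  apply Fin.ext
  unfold key at h
  split_ifs at h <;> omega

open Classical in
/-- number of unrestricted rows of the new tableau -/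
noncomputable def cnt {ι : Type} (k : ι → ℤ) (V S : Finset ι) : ℕ :=
  (if S = ∅ then 1 else 0) + (V.filter (fun r => r ∈ S ∨ ∀ r' ∈ S, ¬ k r' < k r)).card

theorem cnt_sum {ι : Type} (k : ι → ℤ) (hk : Function.Injective k) (u : ℝ) (V : Finset ι) :
    ∑ S ∈ V.powerset, u ^ cnt k V S = u * (1 + u) ^ V.card := by
  classical
  induction V using Finset.induction_on_min_value k with
  | empty => simp [cnt]
  | insert a V ha hmin ih =>
    have hlt : ∀ x ∈ V, k a < k x := fun x hx =>
      lt_of_le_of_ne (hmin x hx) fun h => ha (hk h ▸ hx)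
    rw [Finset.sum_powerset_insert ha, Finset.card_insert_of_notMem ha]
    have h1 : ∀ S ∈ V.powerset, u ^ cnt k (insert a V) S = u * u ^ cnt k V S := by
      intro S hS
      rw [Finset.mem_powerset] at hS
      rw [← pow_succ']
      congr 1
      unfold cnt
      rw [Finset.filter_insert, if_pos (Or.inr fun r' hr' => (hmin _ (hS hr')).not_gt),
        Finset.card_insert_of_notMem (by simp [ha])]
      omega
    have h2 : ∀ S ∈ V.powerset, u ^ cnt k (insert a V) (insert a S) = u * u ^ S.card := by
      intro S hS
      rw [Finset.mem_powerset] at hS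
      rw [← pow_succ']
      congr 1
      unfold cnt
      rw [if_neg (by simp), zero_add, ← Finset.card_insert_of_notMem (fun h => ha (hS h))]
      congr 1
      ext x
      simp only [Finset.mem_filter, Finset.mem_insert]
      constructor
      · rintro ⟨rfl | hx, h⟩
        · exact Or.inl rfl
        · rcases h with h | h
          · exact h
          · exact absurd (hlt x hx) (h a (Or.inl rfl))
      · rintro (rfl | h)
        · simp
        · exact ⟨Or.inr (hS h), Or.inl (Or.inr h)⟩
    rw [Finset.sum_congr rfl h1, Finset.sum_congr rfl h2, ← Finset.mul_sum, ih, ← Finset.mul_sum,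
      pow_sum]
    ring

theorem U_card {n : ℕ} (T : TypeBTableau n) (b : Bool) (S : Finset (Fin n)) (hS : S ⊆ T.U) :
    (T.addStep b S hS).U.card = if b = true then 1 + S.card else cnt (key T.west) T.U S := by
  classical
  have h1 : ∀ x : Fin n, x.castSucc ≠ Fin.last n := fun x => (Fin.castSucc_lt_last x).ne
  rw [U_addStep, Finset.card_union_of_disjoint, Finset.card_map]
  · cases b
    · simp only [cnt, Bool.false_eq_true, false_or, true_and, if_false]
      congr 1
      · split_ifs <;> simp
      · congr
    · simp only [true_or, if_true, Finset.card_singleton]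
      congr 2
      ext x
      simp only [Finset.mem_filter]
      constructor
      · rintro ⟨_, h | h⟩
        · exact h
        · simp at h
      · exact fun h => ⟨hS h, Or.inl h⟩
  · split_ifs <;> simp [h1]

noncomputable def P (n : ℕ) (u : ℝ) : ℝ := ∑ T : TypeBTableau n, u ^ T.U.card
noncomputable def Q (n : ℕ) (u : ℝ) : ℝ := ∑ T : TypeBTableau n, (T.numRows : ℝ) * u ^ T.U.card

theorem P_succ (n : ℕ) (u : ℝ) : P (n+1) u = 2 * u * P n (u + 1) := by
  unfold P
  rw [sum_glue _ (fun T b S => u ^ (if b = true then 1 + S.card else cnt (key T.west) T.U S))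
    (fun T b S hS => by rw [U_card])]
  rw [Finset.mul_sum]
  refine Finset.sum_congr rfl fun T _ => ?_
  simp only [if_true, Bool.false_eq_true, if_false]
  rw [cnt_sum _ (key_inj _)]
  simp only [pow_add, pow_one]
  rw [← Finset.mul_sum, pow_sum, add_comm 1 u]
  ring

theorem Q_succ (n : ℕ) (u : ℝ) : Q (n+1) u = u * P n u + 2 * u * Q n (u + 1) := by
  unfold Q P
  rw [sum_glue _ (fun T b S => ((T.numRows + if b = false ∧ S = ∅ then 1 else 0 : ℕ) : ℝ) *
      u ^ (if b = true then 1 + S.card else cnt (key T.west) T.U S))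
    (fun T b S hS => by rw [U_card, numRows_addStep])]
  rw [Finset.mul_sum, Finset.mul_sum, ← Finset.sum_add_distrib]
  refine Finset.sum_congr rfl fun T _ => ?_
  simp only [if_true, Bool.false_eq_true, if_false, true_and, Bool.true_eq_false, false_and,
    add_zero, Nat.cast_add, add_mul, Finset.sum_add_distrib]
  rw [← Finset.mul_sum, ← Finset.mul_sum, cnt_sum _ (key_inj _)]
  have : ∑ S ∈ T.U.powerset, ((if S = ∅ then 1 else 0 : ℕ) : ℝ) * u ^ cnt (key T.west) T.U S
      = u * u ^ T.U.card := by
    rw [Finset.sum_eq_single ∅]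
    · simp [cnt, pow_add]
    · intro S _ h; simp [h]
    · simp
  rw [this]
  simp only [pow_add, pow_one]
  rw [← Finset.mul_sum, pow_sum, add_comm 1 u]
  ring

instance : Unique (TypeBTableau 0) where
  default := ⟨Fin.elim0, Fin.elim0, fun r => r.elim0, fun r => r.elim0, fun r => r.elim0,
    fun r => r.elim0⟩
  uniq T := ext_wf (Subsingleton.elim _ _) (Subsingleton.elim _ _)

theorem P_zero (u : ℝ) : P 0 u = 1 := by
  simp [P, Fintype.card_unique, Finset.eq_empty_of_isEmpty]

theorem Q_zero (u : ℝ) : Q 0 u = 0 := by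
  simp [Q, numRows, Finset.eq_empty_of_isEmpty]

def asc : ℕ → ℝ → ℝ
  | 0, _ => 1
  | n+1, u => u * asc n (u + 1)

theorem asc_succ' (n : ℕ) (u : ℝ) : asc (n+1) u = asc n u * (u + n) := by
  induction n generalizing u with
  | zero => simp [asc]
  | succ n ih => rw [asc, ih, asc]; push_cast; ring

theorem P_eq (n : ℕ) (u : ℝ) : P n u = 2 ^ n * asc n u := by
  induction n generalizing u with
  | zero => simp [P_zero, asc]
  | succ n ih => rw [P_succ, ih, asc]; ring

theorem Q_eq (n : ℕ) (u : ℝ) : Q (n+1) u = 2 ^ n * asc n u * ((n + 1) * (u + n / 2)) := by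
  induction n generalizing u with
  | zero => simp [Q_succ, P_zero, Q_zero, asc]
  | succ n ih => rw [Q_succ, ih, P_eq, asc]; push_cast; ring

end TypeBTableau

/-- The total number of rows over all type-B permutation tableaux of size `n`
equals `((n+1)/4) · |B_n|`; i.e. the expected number of rows of a uniformly
random type-B permutation tableau of size `n` is `(n+1)/4`. -/
theorem expected_rows (n : ℕ) (hn : 1 ≤ n) :
    (∑ T : TypeBTableau n, (T.numRows : ℝ)) =
      ((n : ℝ) + 1) / 4 * (Fintype.card (TypeBTableau n) : ℝ) := by
  obtain ⟨m, rfl⟩ := Nat.exists_eq_add_of_le' hn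
  have h1 : (∑ T : TypeBTableau (m+1), (T.numRows : ℝ)) = TypeBTableau.Q (m+1) 1 := by
    simp [TypeBTableau.Q]
  have h2 : (Fintype.card (TypeBTableau (m+1)) : ℝ) = TypeBTableau.P (m+1) 1 := by
    simp [TypeBTableau.P]
  rw [h1, h2, TypeBTableau.Q_eq, TypeBTableau.P_eq, TypeBTableau.asc_succ']
  push_cast
  ring
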